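/- arXiv:2301.10806 — 3 statements merged into one kernel-verified Lean document; each statement's English description precedes it below -/
import Mathlib

section
/- For every μ ∈ V_n: (a) Tr(M_μ) = −‖μ‖², where ‖μ‖ is the norm of μ in V_n; and (b) for every derivation D of μ, Tr(M_μ D*) = 0. -/
open Matrix

noncomputable section

/-- `Vn n` is the space of `n`-dimensional commutative complex algebras, i.e. symmetric
ℂ-bilinear maps `ℂⁿ × ℂⁿ → ℂⁿ`, encoded by structure constants with respect to the
standard basis: `μ i j k` is the `e k`-coordinate of `μ(e i, e j)`. -/
abbrev Vn (n : ℕ) : Type := Fin n → Fin n → Fin n → ℂ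

namespace Vn

variable {n : ℕ}

/-- symmetry (commutativity) of the multiplication -/
def IsSymm (μ : Vn n) : Prop := ∀ i j k, μ i j k = μ j i k

/-- the product `μ(x, y)` -/
def mul (μ : Vn n) (x y : Fin n → ℂ) : Fin n → ℂ :=
  fun k => ∑ i, ∑ j, x i * y j * μ i j k

/-- left multiplication `L^μ_x`, as a matrix -/
def L (μ : Vn n) (x : Fin n → ℂ) : Matrix (Fin n) (Fin n) ℂ :=
  Matrix.of fun k j => ∑ i, x i * μ i j k

/-- the standard Hermitian inner product on `ℂⁿ` (linear in the first variable) -/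
def herm (x y : Fin n → ℂ) : ℂ := ∑ i, x i * star (y i)

/-- the moment matrix `M_μ = -2 ∑ᵢ (L_{xᵢ})* L_{xᵢ} + ∑ᵢ L_{xᵢ} (L_{xᵢ})*`,
computed with respect to the standard orthonormal basis of `ℂⁿ` -/
def Mmat (μ : Vn n) : Matrix (Fin n) (Fin n) ℂ :=
  (-2 : ℂ) • ∑ i, (L μ (Pi.single i 1))ᴴ * L μ (Pi.single i 1)
    + ∑ i, L μ (Pi.single i 1) * (L μ (Pi.single i 1))ᴴ

/-- the Hermitian product on `Vn n` -/
def innerV (μ ν : Vn n) : ℂ := ∑ i, ∑ j, ∑ k, μ i j k * star (ν i j k)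

/-- the squared norm `‖μ‖²` on `Vn n` -/
def normSqV (μ : Vn n) : ℝ := ∑ i, ∑ j, ∑ k, Complex.normSq (μ i j k)

/-- the infinitesimal change-of-basis action of `gl(n, ℂ)` on `Vn n`:
`(A·μ)(x,y) = A(μ(x,y)) - μ(Ax,y) - μ(x,Ay)` -/
def glAct (A : Matrix (Fin n) (Fin n) ℂ) (μ : Vn n) : Vn n :=
  fun i j k =>
    (A *ᵥ mul μ (Pi.single i 1) (Pi.single j 1)
      - mul μ (A *ᵥ Pi.single i 1) (Pi.single j 1)
      - mul μ (Pi.single i 1) (A *ᵥ Pi.single j 1)) k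

/-- the change-of-basis action of `GL(n, ℂ)` on `Vn n`:
`(g·μ)(x,y) = g(μ(g⁻¹x, g⁻¹y))` -/
def gAct (g : GL (Fin n) ℂ) (μ : Vn n) : Vn n :=
  fun i j k =>
    ((g : Matrix (Fin n) (Fin n) ℂ) *ᵥ
      mul μ ((↑g⁻¹ : Matrix (Fin n) (Fin n) ℂ) *ᵥ Pi.single i 1)
            ((↑g⁻¹ : Matrix (Fin n) (Fin n) ℂ) *ᵥ Pi.single j 1)) k

/-- the `GL(n,ℂ)`-orbit (isomorphism class) of `μ` -/
def orbit (μ : Vn n) : Set (Vn n) := { ν | ∃ g : GL (Fin n) ℂ, ν = gAct g μ }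

/-- `D` is a derivation of `μ` -/
def IsDeriv (μ : Vn n) (D : Matrix (Fin n) (Fin n) ℂ) : Prop :=
  ∀ x y, D *ᵥ mul μ x y = mul μ (D *ᵥ x) y + mul μ x (D *ᵥ y)

/-- the associator `(a,b,c) = (ab)c - a(bc)` -/
def assoc (μ : Vn n) (a b c : Fin n → ℂ) : Fin n → ℂ :=
  mul μ (mul μ a b) c - mul μ a (mul μ b c)

/-- `μ` is a Jordan algebra: commutative and satisfying the linearized Jordan identity
`(ab,c,d) + (bd,c,a) + (da,c,b) = 0` -/
def IsJordan (μ : Vn n) : Prop :=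
  IsSymm μ ∧ ∀ a b c d : Fin n → ℂ,
    assoc μ (mul μ a b) c d + assoc μ (mul μ b d) c a + assoc μ (mul μ d a) c b = 0

/-- `μ` is a soliton: `μ ≠ 0` and `M_μ · μ ∈ ℝ μ` -/
def IsSoliton (μ : Vn n) : Prop :=
  μ ≠ 0 ∧ ∃ c : ℝ, glAct (Mmat μ) μ = (c : ℂ) • μ

/-- the constant `c_μ = -Tr(M_μ²)/‖μ‖²` -/
def cconst (μ : Vn n) : ℝ := -(Matrix.trace (Mmat μ * Mmat μ)).re / normSqV μ

/-- `D_μ = M_μ - c_μ • I` -/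
def Dmat (μ : Vn n) : Matrix (Fin n) (Fin n) ℂ := Mmat μ - (cconst μ : ℂ) • 1

/-- the energy `E_n(μ) = Tr(M_μ²)/‖μ‖⁴` -/
def energy (μ : Vn n) : ℝ := (Matrix.trace (Mmat μ * Mmat μ)).re / (normSqV μ) ^ 2

/-- the trace form `τ_μ(x, y) = Tr L_{μ(x,y)}` -/
def traceForm (μ : Vn n) (x y : Fin n → ℂ) : ℂ := Matrix.trace (L μ (mul μ x y))

/-- nondegeneracy of the trace form (Albert's criterion for semisimplicity) -/
def TraceFormNondeg (μ : Vn n) : Prop := ∀ x, (∀ y, traceForm μ x y = 0) → x = 0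

end Vn


namespace Vn

variable {n : ℕ}

@[simp]
lemma L_single_apply (μ : Vn n) (i k j : Fin n) : L μ (Pi.single i 1) k j = μ i j k := by
  simp [L, Pi.single_apply]

lemma mul_single_right (μ : Vn n) (x : Fin n → ℂ) (j k : Fin n) :
    mul μ x (Pi.single j 1) k = ∑ i, x i * μ i j k := by
  simp [mul, Pi.single_apply]

lemma mul_single_left (μ : Vn n) (y : Fin n → ℂ) (i k : Fin n) :
    mul μ (Pi.single i 1) y k = ∑ j, y j * μ i j k := by
  simp [mul, Pi.single_apply]

lemma mul_single_single (μ : Vn n) (i j : Fin n) :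
    mul μ (Pi.single i 1) (Pi.single j 1) = μ i j := by
  ext k
  simp [mul_single_left, Pi.single_apply]

lemma glAct_apply (A : Matrix (Fin n) (Fin n) ℂ) (μ : Vn n) (i j k : Fin n) :
    glAct A μ i j k =
      ∑ l, A k l * μ i j l - ∑ l, A l i * μ l j k - ∑ l, A l j * μ i l k := by
  simp [glAct, mul_single_single, mul_single_left, mul_single_right, Matrix.mulVec, dotProduct]

lemma glAct_one (μ : Vn n) : glAct 1 μ = -μ := by
  ext i j k
  simp only [glAct, one_mulVec, mul_single_single]
  simp

lemma IsDeriv.glAct_eq_zero {μ : Vn n} {D : Matrix (Fin n) (Fin n) ℂ} (hD : IsDeriv μ D) :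
    glAct D μ = 0 := by
  ext i j k
  simp [glAct, hD (Pi.single i 1) (Pi.single j 1)]

lemma innerV_self (μ : Vn n) : innerV μ μ = (normSqV μ : ℂ) := by
  simp [innerV, normSqV, Complex.mul_conj]

lemma trace_sum_L_mul_conjTranspose (μ : Vn n) (A : Matrix (Fin n) (Fin n) ℂ) :
    trace ((∑ i, L μ (Pi.single i 1) * (L μ (Pi.single i 1))ᴴ) * Aᴴ) =
      ∑ i, ∑ j, ∑ k, μ i j k * star (∑ l, A k l * μ i j l) := by
  rw [Finset.sum_mul, trace_sum]
  refine Finset.sum_congr rfl fun i _ => ?_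
  rw [Matrix.mul_assoc, ← conjTranspose_mul, trace]
  simp only [diag_apply, Matrix.mul_apply, conjTranspose_apply, L_single_apply]
  exact Finset.sum_comm

lemma trace_sum_conjTranspose_mul_L (μ : Vn n) (A : Matrix (Fin n) (Fin n) ℂ) :
    trace ((∑ i, (L μ (Pi.single i 1))ᴴ * L μ (Pi.single i 1)) * Aᴴ) =
      ∑ i, ∑ j, ∑ k, μ i j k * star (∑ l, A l j * μ i l k) := by
  rw [Finset.sum_mul, trace_sum]
  refine Finset.sum_congr rfl fun i _ => ?_
  rw [Matrix.mul_assoc, trace_mul_comm, Matrix.mul_assoc, ← conjTranspose_mul, trace]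
  simp only [diag_apply, Matrix.mul_apply, conjTranspose_apply, L_single_apply, mul_comm (A _ _)]
  exact Finset.sum_comm

/-- The defining property of the moment matrix: `Tr(M_μ A*) = ⟨μ, A·μ⟩`. -/
lemma trace_Mmat_mul_conjTranspose {μ : Vn n} (hμ : IsSymm μ) (A : Matrix (Fin n) (Fin n) ℂ) :
    trace (Mmat μ * Aᴴ) = innerV μ (glAct A μ) := by
  have hswap : ∑ i, ∑ j, ∑ k, μ i j k * star (∑ l, A l i * μ l j k) =
      ∑ i, ∑ j, ∑ k, μ i j k * star (∑ l, A l j * μ i l k) := by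
    rw [Finset.sum_comm]
    refine Finset.sum_congr rfl fun i _ => Finset.sum_congr rfl fun j _ =>
      Finset.sum_congr rfl fun k _ => ?_
    rw [hμ j i k]
    simp only [fun l => hμ l i k]
  simp only [innerV, glAct_apply, star_sub, mul_sub, Finset.sum_sub_distrib]
  rw [hswap, Mmat, Matrix.add_mul, Matrix.smul_mul, trace_add, trace_smul,
    trace_sum_L_mul_conjTranspose, trace_sum_conjTranspose_mul_L, smul_eq_mul]
  ring

end Vn

/-- for every symmetric `μ ∈ V_n`: (a) `Tr(M_μ) = -‖μ‖²`, and
(b) `Tr(M_μ D*) = 0` for every derivation `D` of `μ`. -/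
theorem stmt2 {n : ℕ} (μ : Vn n) (hμ : Vn.IsSymm μ) :
    Matrix.trace (Vn.Mmat μ) = -(Vn.normSqV μ : ℂ) ∧
    ∀ D : Matrix (Fin n) (Fin n) ℂ, Vn.IsDeriv μ D →
      Matrix.trace (Vn.Mmat μ * Dᴴ) = 0 := by
  refine ⟨?_, fun D hD => ?_⟩
  · have h := Vn.trace_Mmat_mul_conjTranspose hμ 1
    rw [conjTranspose_one, Matrix.mul_one, Vn.glAct_one] at h
    rw [h, ← Vn.innerV_self]
    simp [Vn.innerV]
  · rw [Vn.trace_Mmat_mul_conjTranspose hμ, hD.glAct_eq_zero]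
    simp [Vn.innerV]
end
end

section
/- For n ≥ 2, the Jordan algebras μ_Heis and μ_hyp are solitons (their moment matrices satisfy M_μ·μ ∈ ℝ·μ). Moreover M_{μ_Heis} = diag(−2, 1, 0, …, 0), so E_n(μ_Heis) = 5, and M_{μ_hyp} = diag(−(n+1)/2, 0, …, 0), so E_n(μ_hyp) = 1. -/
open Matrix

noncomputable section

/-- the Heisenberguian Jordan algebra `μ_Heis`: `μ(e₀,e₀) = e₁`, all other products of
basis vectors zero -/
def muHeis (n : ℕ) : Vn n := fun i j k =>
  if i.val = 0 ∧ j.val = 0 ∧ k.val = 1 then 1 else 0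

/-- the hyperbolic Jordan algebra `μ_hyp`: `μ(e₀,e₀) = e₀`, `μ(e₀,eᵢ) = μ(eᵢ,e₀) = (1/2)eᵢ`
for `i ≥ 1`, all other products of basis vectors zero -/
def muHyp (n : ℕ) : Vn n := fun i j k =>
  if i.val = 0 ∧ j.val = 0 ∧ k.val = 0 then 1
  else if i.val = 0 ∧ j = k then 1/2
  else if j.val = 0 ∧ i = k then 1/2
  else 0

namespace Vn

variable {n : ℕ}

lemma Mmat_apply (μ : Vn n) (p q : Fin n) :
    Mmat μ p q = -2 * ∑ i, ∑ k, star (μ i p k) * μ i q k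
      + ∑ i, ∑ k, μ i k p * star (μ i k q) := by
  simp [Mmat, L, Matrix.add_apply, Matrix.sum_apply, Matrix.mul_apply, Pi.single_apply]

lemma glAct_diagonal (d : Fin n → ℂ) (μ : Vn n) (i j k : Fin n) :
    glAct (Matrix.diagonal d) μ i j k = (d k - d i - d j) * μ i j k := by
  simp [glAct, mul, Matrix.mulVec_diagonal, Pi.single_apply]
  ring

lemma isSoliton_of_Mmat_eq_diagonal {μ : Vn n} (hμ : μ ≠ 0) {d : Fin n → ℂ}
    (hM : Mmat μ = Matrix.diagonal d) (c : ℝ)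
    (hc : ∀ i j k, μ i j k ≠ 0 → d k - d i - d j = c) : IsSoliton μ := by
  refine ⟨hμ, c, ?_⟩
  ext i j k
  rw [hM, glAct_diagonal]
  by_cases h : μ i j k = 0
  · simp [h]
  · simp [hc i j k h]

lemma energy_of_Mmat_eq_diagonal {μ : Vn n} {d : Fin n → ℂ} (hM : Mmat μ = Matrix.diagonal d) :
    energy μ = (∑ i, d i * d i).re / normSqV μ ^ 2 := by
  rw [energy, hM, Matrix.diagonal_mul_diagonal, Matrix.trace_diagonal]

end Vn

lemma muHeis_apply {m : ℕ} (i j k : Fin (m + 2)) :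
    muHeis (m + 2) i j k = if i = 0 then if j = 0 then if k = 1 then 1 else 0 else 0 else 0 := by
  simp only [muHeis, Fin.ext_iff, Fin.val_zero, Fin.val_one, ← ite_and]

lemma Mmat_muHeis (m : ℕ) :
    Vn.Mmat (muHeis (m + 2)) =
      Matrix.diagonal (fun i => if i.val = 0 then -2 else if i.val = 1 then 1 else 0) := by
  ext p q
  have h0 (i : Fin (m + 2)) : i.val = 0 ↔ i = 0 := by rw [Fin.ext_iff]; rfl
  have h1 (i : Fin (m + 2)) : i.val = 1 ↔ i = 1 := by rw [Fin.ext_iff]; rfl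
  rw [Vn.Mmat_apply, Matrix.diagonal_apply]
  simp only [muHeis_apply, h0, h1]
  by_cases hp : p = 0 <;> by_cases hq : q = 0 <;> by_cases hp' : p = 1 <;> by_cases hq' : q = 1 <;>
    simp_all [eq_comm]

lemma normSqV_muHeis (m : ℕ) : Vn.normSqV (muHeis (m + 2)) = 1 := by
  simp [Vn.normSqV, muHeis_apply, apply_ite Complex.normSq]

lemma muHyp_zero_apply {m : ℕ} (j k : Fin (m + 1)) :
    muHyp (m + 1) 0 j k = if j = k then if k = 0 then 1 else 1 / 2 else 0 := by
  simp only [muHyp, Fin.ext_iff, Fin.val_zero]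
  split_ifs <;> grind

lemma muHyp_succ_apply {m : ℕ} (i : Fin m) (j k : Fin (m + 1)) :
    muHyp (m + 1) i.succ j k = if j = 0 then if k = i.succ then 1 / 2 else 0 else 0 := by
  simp only [muHyp, Fin.ext_iff, Fin.val_zero, Fin.val_succ]
  split_ifs <;> grind

lemma Mmat_muHyp (m : ℕ) :
    Vn.Mmat (muHyp (m + 1)) =
      Matrix.diagonal (fun i => if i.val = 0 then -(((m + 1 : ℕ) + 1 : ℂ) / 2) else 0) := by
  ext p q
  rw [Vn.Mmat_apply, Matrix.diagonal_apply,
    Fin.sum_univ_succ (fun i => ∑ k, star (muHyp (m + 1) i p k) * muHyp (m + 1) i q k),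
    Fin.sum_univ_succ (fun i => ∑ k, muHyp (m + 1) i k p * star (muHyp (m + 1) i k q))]
  simp only [muHyp_zero_apply, muHyp_succ_apply]
  refine Fin.cases ?_ (fun p => ?_) p <;> refine Fin.cases ?_ (fun q => ?_) q
  · simp [(Fin.succ_ne_zero _).symm, Complex.conj_ofNat]
    ring
  · simp [Fin.succ_ne_zero, (Fin.succ_ne_zero _).symm]
  · simp [Fin.succ_ne_zero, (Fin.succ_ne_zero _).symm]
  · by_cases h : p = q
    · subst h
      simp [Fin.succ_ne_zero, Complex.conj_ofNat]
      norm_num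
    · simp [Fin.succ_ne_zero, h, Ne.symm h]

lemma normSqV_muHyp (m : ℕ) : Vn.normSqV (muHyp (m + 1)) = ((m : ℝ) + 2) / 2 := by
  rw [Vn.normSqV, Fin.sum_univ_succ]
  simp [muHyp_zero_apply, muHyp_succ_apply, apply_ite Complex.normSq, Fin.sum_univ_succ,
    Fin.succ_ne_zero]
  ring

/-- for `n ≥ 2`, `μ_Heis` and `μ_hyp` are solitons; moreover
`M_{μ_Heis} = diag(-2, 1, 0, …, 0)`, `E_n(μ_Heis) = 5`, and
`M_{μ_hyp} = diag(-(n+1)/2, 0, …, 0)`, `E_n(μ_hyp) = 1`. -/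
theorem stmt10 {n : ℕ} (hn : 2 ≤ n) :
    Vn.IsSoliton (muHeis n) ∧ Vn.IsSoliton (muHyp n) ∧
    Vn.Mmat (muHeis n) =
      Matrix.diagonal (fun i : Fin n => if i.val = 0 then -2 else if i.val = 1 then 1 else 0) ∧
    Vn.energy (muHeis n) = 5 ∧
    Vn.Mmat (muHyp n) =
      Matrix.diagonal (fun i : Fin n => if i.val = 0 then -(((n : ℂ) + 1) / 2) else 0) ∧
    Vn.energy (muHyp n) = 1 := by
  obtain ⟨m, rfl⟩ := Nat.exists_eq_add_of_le' hn
  refine ⟨Vn.isSoliton_of_Mmat_eq_diagonal ?_ (Mmat_muHeis m) 5 ?_,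
    Vn.isSoliton_of_Mmat_eq_diagonal ?_ (Mmat_muHyp (m + 1)) (((m : ℝ) + 3) / 2) ?_,
    Mmat_muHeis m, ?_, Mmat_muHyp (m + 1), ?_⟩
  · intro h
    simpa [muHeis_apply] using congrFun₃ h 0 0 1
  · intro i j k h
    simp only [muHeis_apply, ne_eq, ite_eq_right_iff, not_forall] at h
    obtain ⟨rfl, rfl, rfl, -⟩ := h
    norm_num
  · intro h
    simpa [muHyp_zero_apply] using congrFun₃ h 0 0 0
  · intro i j k h
    refine Fin.cases (fun h => ?_) (fun i h => ?_) i h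
    · simp only [muHyp_zero_apply, ne_eq, ite_eq_right_iff, not_forall] at h
      obtain ⟨rfl, -⟩ := h
      push_cast
      simp
      ring
    · simp only [muHyp_succ_apply, ne_eq, ite_eq_right_iff, not_forall] at h
      obtain ⟨rfl, rfl, -⟩ := h
      push_cast
      simp
      ring
  · rw [Vn.energy_of_Mmat_eq_diagonal (Mmat_muHeis m), normSqV_muHeis]
    simp [Fin.sum_univ_succ]
    norm_num
  · rw [Vn.energy_of_Mmat_eq_diagonal (Mmat_muHyp (m + 1)), normSqV_muHyp]
    have h : (((m + 1 : ℕ) : ℝ) + 2) / 2 ≠ 0 := by positivity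
    rw [div_eq_one_iff_eq (pow_ne_zero 2 h), ← Complex.ofReal_re (_ ^ 2)]
    congr 1
    simp
    ring
end
end

section
/- For n ≥ 2 the maximum value of the energy E_n on nonzero Jordan algebras is 5, attained exactly on the orbit of μ_Heis: for every nonzero μ ∈ 𝒥_n one has E_n(μ) ≤ 5, with equality if and only if μ ∈ GL(n,ℂ)·μ_Heis. -/
open Matrix

noncomputable section

namespace Vn
variable {n : ℕ}

/-- The squared Frobenius norm of a complex matrix. -/
def frobSq {m n : Type*} [Fintype m] [Fintype n] (X : Matrix m n ℂ) : ℝ :=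
  ∑ p, ∑ j, Complex.normSq (X p j)

/-- The matrix of all `2 × 2` minors of `X`, indexed by ordered pairs of rows and columns. -/
def minors {m n : Type*} (X : Matrix m n ℂ) : Matrix (m × m) (n × n) ℂ :=
  of fun p j => X p.1 j.1 * X p.2 j.2 - X p.1 j.2 * X p.2 j.1

theorem frobSq_nonneg {m n : Type*} [Fintype m] [Fintype n] (X : Matrix m n ℂ) : 0 ≤ frobSq X :=
  Finset.sum_nonneg fun _ _ => Finset.sum_nonneg fun _ _ => Complex.normSq_nonneg _

theorem frobSq_eq_zero_iff {m n : Type*} [Fintype m] [Fintype n] {X : Matrix m n ℂ} :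
    frobSq X = 0 ↔ X = 0 := by
  have hrow : ∀ p, 0 ≤ ∑ j, Complex.normSq (X p j) :=
    fun p => Finset.sum_nonneg fun _ _ => Complex.normSq_nonneg _
  have hentry : ∀ p, ∑ j, Complex.normSq (X p j) = 0 ↔ ∀ j, X p j = 0 := fun p => by
    simp [Finset.sum_eq_zero_iff_of_nonneg fun j _ => Complex.normSq_nonneg (X p j)]
  simp [frobSq, Finset.sum_eq_zero_iff_of_nonneg fun p _ => hrow p, hentry, ← Matrix.ext_iff]

theorem frobSq_minors {m n : Type*} [Fintype m] [Fintype n] (X : Matrix m n ℂ) :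
    frobSq (minors X) = 2 * (frobSq X ^ 2 - (trace (Xᴴ * X * (Xᴴ * X))).re) := by
  have h1 : frobSq X ^ 2 =
      ∑ p, ∑ q, ∑ j, ∑ k, Complex.normSq (X p j) * Complex.normSq (X q k) := by
    simp_rw [frobSq, sq, Finset.sum_mul_sum]
  have h1' : frobSq X ^ 2 =
      ∑ p, ∑ q, ∑ j, ∑ k, Complex.normSq (X p k) * Complex.normSq (X q j) := by
    rw [h1]
    exact Finset.sum_congr rfl fun p _ => Finset.sum_congr rfl fun q _ => Finset.sum_comm
  have h2 : (trace (Xᴴ * X * (Xᴴ * X))).re =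
      ∑ p, ∑ q, ∑ j, ∑ k, (X p j * X q k * star (X p k * X q j)).re := by
    simp_rw [← Complex.re_sum]
    congr 1
    simp only [trace, diag_apply, mul_apply, conjTranspose_apply, Finset.sum_mul_sum]
    simp_rw [Finset.sum_comm (s := (Finset.univ : Finset n)) (t := (Finset.univ : Finset m))]
    rw [Finset.sum_comm]
    refine Finset.sum_congr rfl fun p _ => Finset.sum_congr rfl fun q _ =>
      Finset.sum_congr rfl fun j _ => Finset.sum_congr rfl fun k _ => ?_
    rw [star_mul]
    ring
  calc _ = ∑ p, ∑ q, ∑ j, ∑ k, (Complex.normSq (X p j) * Complex.normSq (X q k)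
            + Complex.normSq (X p k) * Complex.normSq (X q j)
            - 2 * (X p j * X q k * star (X p k * X q j)).re) := by
        simp only [frobSq, minors, of_apply, Fintype.sum_prod_type, Complex.normSq_sub,
          Complex.normSq_mul, starRingEnd_apply]
    _ = frobSq X ^ 2 + frobSq X ^ 2 - 2 * (trace (Xᴴ * X * (Xᴴ * X))).re := by
        rw [h2]
        nth_rw 1 [h1]
        rw [h1']
        simp only [Finset.sum_sub_distrib, Finset.sum_add_distrib, Finset.mul_sum]
    _ = _ := by ring

theorem trace_conjTranspose_mul_self_re {m n : Type*} [Fintype m] [Fintype n]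
    (X : Matrix m n ℂ) : (trace (Xᴴ * X)).re = frobSq X := by
  simp only [frobSq, trace, diag_apply, mul_apply, conjTranspose_apply, Complex.re_sum]
  rw [Finset.sum_comm]
  refine Finset.sum_congr rfl fun p _ => Finset.sum_congr rfl fun q _ => ?_
  simp [Complex.normSq_apply]

/-- The flattening of `μ` sending `y` to the family of coordinates of all `μ(e i, y)`. -/
def flatIn (μ : Vn n) : Matrix (Fin n × Fin n) (Fin n) ℂ := of fun p j => μ p.1 j p.2

/-- The flattening of `μ` sending `e i ⊗ e j` to `μ(e i, e j)`. -/
def flatOut (μ : Vn n) : Matrix (Fin n) (Fin n × Fin n) ℂ := of fun k p => μ p.1 p.2 k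

theorem Mmat_eq (μ : Vn n) :
    Mmat μ = (-2 : ℂ) • ((flatIn μ)ᴴ * flatIn μ) + flatOut μ * (flatOut μ)ᴴ := by
  ext a b
  simp [Mmat, flatIn, flatOut, L, mul_apply, Matrix.sum_apply, Fintype.sum_prod_type,
    Pi.single_apply]

theorem frobSq_flatIn (μ : Vn n) : frobSq (flatIn μ) = normSqV μ := by
  simp only [frobSq, flatIn, of_apply, Fintype.sum_prod_type, normSqV]
  exact Finset.sum_congr rfl fun i _ => Finset.sum_comm

theorem frobSq_flatOut (μ : Vn n) : frobSq (flatOut μ)ᴴ = normSqV μ := by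
  simp [frobSq, flatOut, Fintype.sum_prod_type, normSqV]

theorem trace_Mmat_sq (μ : Vn n) :
    (trace (Mmat μ * Mmat μ)).re =
      4 * (trace ((flatIn μ)ᴴ * flatIn μ * ((flatIn μ)ᴴ * flatIn μ))).re
      + (trace ((flatOut μ)ᴴᴴ * (flatOut μ)ᴴ * ((flatOut μ)ᴴᴴ * (flatOut μ)ᴴ))).re
      - 4 * frobSq (flatIn μ * flatOut μ) := by
  rw [← trace_conjTranspose_mul_self_re, conjTranspose_mul, conjTranspose_conjTranspose]
  have h : trace ((flatOut μ)ᴴ * (flatIn μ)ᴴ * (flatIn μ * flatOut μ)) =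
      trace ((flatIn μ)ᴴ * flatIn μ * (flatOut μ * (flatOut μ)ᴴ)) := by
    rw [Matrix.mul_assoc, trace_mul_comm]
    simp only [Matrix.mul_assoc]
  rw [h, Mmat_eq, Matrix.add_mul, Matrix.mul_add, Matrix.mul_add]
  simp only [Matrix.smul_mul, Matrix.mul_smul, trace_add, trace_smul]
  rw [trace_mul_comm (flatOut μ * (flatOut μ)ᴴ) ((flatIn μ)ᴴ * flatIn μ)]
  simp
  ring

theorem normSqV_pos {μ : Vn n} (h0 : μ ≠ 0) : 0 < normSqV μ := by
  obtain ⟨i, hi⟩ := Function.ne_iff.1 h0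
  obtain ⟨j, hj⟩ := Function.ne_iff.1 hi
  obtain ⟨k, hk⟩ := Function.ne_iff.1 hj
  have hnn := Complex.normSq_nonneg
  refine Finset.sum_pos' (fun _ _ => Finset.sum_nonneg fun _ _ => Finset.sum_nonneg fun _ _ => hnn _)
    ⟨i, Finset.mem_univ _, Finset.sum_pos' (fun _ _ => Finset.sum_nonneg fun _ _ => hnn _)
      ⟨j, Finset.mem_univ _, Finset.sum_pos' (fun _ _ => hnn _)
        ⟨k, Finset.mem_univ _, Complex.normSq_pos.2 hk⟩⟩⟩

/-- The energy deficit as a sum of squares of `2 × 2` minors and of double products. -/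
theorem trace_Mmat_sq_add_deficit (μ : Vn n) :
    (trace (Mmat μ * Mmat μ)).re
      + (2 * frobSq (minors (flatIn μ)) + 1 / 2 * frobSq (minors (flatOut μ)ᴴ)
        + 4 * frobSq (flatIn μ * flatOut μ)) = 5 * normSqV μ ^ 2 := by
  rw [frobSq_minors, frobSq_minors, frobSq_flatIn, frobSq_flatOut, trace_Mmat_sq]
  ring

theorem exists_eq_mul_of_minors {μ : Vn n} (hs : IsSymm μ) (h0 : μ ≠ 0)
    (h : minors (flatIn μ) = 0) :
    ∃ φ w : Fin n → ℂ, φ ≠ 0 ∧ w ≠ 0 ∧ ∀ i j k, μ i j k = φ i * φ j * w k := by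
  obtain ⟨a, ha⟩ := Function.ne_iff.1 h0
  obtain ⟨b, hb⟩ := Function.ne_iff.1 ha
  obtain ⟨c, hc⟩ := Function.ne_iff.1 hb
  replace hc : μ a b c ≠ 0 := hc
  have hm : ∀ i k i' k' j j', μ i j k * μ i' j' k' = μ i j' k * μ i' j k' :=
    fun i k i' k' j j' =>
      sub_eq_zero.1 (congrFun (congrFun h ((i, k), (i', k'))) (j, j'))
  have key : ∀ i j k, μ i j k = μ a i c * μ a j c * (μ b b k / μ a b c ^ 2) := by
    intro i j k
    have h1 := hm i k a c j b
    have h2 := hm b k a c i b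
    rw [hs i b k] at h1
    field_simp
    linear_combination μ a b c * h1 + μ a j c * h2
  refine ⟨fun i => μ a i c, fun k => μ b b k / μ a b c ^ 2, ?_, ?_, key⟩
  · intro h
    exact hc (congrFun h b)
  · intro h
    exact hc (by rw [key, congrFun h c]; simp)

theorem gAct_muHeis (hn : 2 ≤ n) (g : GL (Fin n) ℂ) (i j k : Fin n) :
    gAct g (muHeis n) i j k = (↑g⁻¹ : Matrix (Fin n) (Fin n) ℂ) ⟨0, by omega⟩ i *
      (↑g⁻¹ : Matrix (Fin n) (Fin n) ℂ) ⟨0, by omega⟩ j *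
      (g : Matrix (Fin n) (Fin n) ℂ) k ⟨1, by omega⟩ := by
  have e : muHeis n = fun i j k => if i = ⟨0, by omega⟩ then if j = ⟨0, by omega⟩ then
      if k = ⟨1, by omega⟩ then 1 else 0 else 0 else 0 := by
    funext i j k
    simp only [muHeis, Fin.ext_iff, ← ite_and]
  simp only [gAct, e, mulVec_single_one]
  simp [mulVec, dotProduct, mul]
  ring

theorem exists_GL {φ w : Fin n → ℂ} (a b : Fin n) (hab : a ≠ b) (hφ : φ ≠ 0) (hw : w ≠ 0)
    (h : φ ⬝ᵥ w = 0) : ∃ g : GL (Fin n) ℂ,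
      (∀ i, (↑g⁻¹ : Matrix (Fin n) (Fin n) ℂ) a i = φ i) ∧
      ∀ k, (g : Matrix (Fin n) (Fin n) ℂ) k b = w k := by
  obtain ⟨p, hp⟩ := Function.ne_iff.1 hφ
  obtain ⟨q, hqp, hq⟩ : ∃ q, q ≠ p ∧ w q ≠ 0 := by
    by_contra! hc
    obtain ⟨q, hq⟩ := Function.ne_iff.1 hw
    obtain rfl : q = p := by
      by_contra hqp
      exact hq (hc q hqp)
    rw [dotProduct, Finset.sum_eq_single q (fun i _ hi => by rw [hc i hi, mul_zero])
      (by simp)] at h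
    exact mul_ne_zero hp hq h
  obtain ⟨σ, hσa, hσb⟩ : ∃ σ : Equiv.Perm (Fin n), σ a = p ∧ σ b = q := by
    refine ⟨Equiv.swap a p |>.trans (Equiv.swap (Equiv.swap a p b) q), ?_, ?_⟩
    · simp only [Equiv.trans_apply, Equiv.swap_apply_left]
      refine Equiv.swap_apply_of_ne_of_ne ?_ hqp.symm
      intro h
      exact hab ((Equiv.swap a p).injective ((Equiv.swap_apply_left a p).trans h))
    · simp
  obtain ⟨C, hC⟩ : IsUnit (((1 : Matrix (Fin n) (Fin n) ℂ).updateCol q w).submatrix id σ) := by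
    rw [isUnit_iff_isUnit_det, det_permute', ← cramer_apply, cramer_one]
    simpa using hq
  have hCa : ∀ i, (C : Matrix (Fin n) (Fin n) ℂ) i a = (Pi.single p 1 : Fin n → ℂ) i := by
    intro i
    rw [hC, submatrix_apply, hσa, updateCol_ne hqp.symm, one_apply, Pi.single_apply]
    rfl
  have hCb : ∀ i, (C : Matrix (Fin n) (Fin n) ℂ) i b = w i := by
    intro i
    rw [hC, submatrix_apply, hσb, updateCol_self]
    rfl
  set ψ : Fin n → ℂ := φ ᵥ* (C : Matrix (Fin n) (Fin n) ℂ) with hψ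
  have hψa : ψ a ≠ 0 := by
    simpa [hψ, vecMul, dotProduct, hCa, Pi.single_apply] using hp
  have hψb : ψ b = 0 := by
    rw [← h, hψ, vecMul]
    exact congrArg _ (funext hCb)
  obtain ⟨R, hR⟩ : IsUnit ((1 : Matrix (Fin n) (Fin n) ℂ).updateRow a ψ) := by
    rw [isUnit_iff_isUnit_det, ← det_transpose, ← updateCol_transpose, transpose_one,
      ← cramer_apply, cramer_one]
    simpa using hψa
  refine ⟨C * R⁻¹, fun i => ?_, fun k => ?_⟩
  · have h1 : ((R * C⁻¹ : GL (Fin n) ℂ) : Matrix (Fin n) (Fin n) ℂ) a =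
        φ ᵥ* ((C * C⁻¹ : GL (Fin n) ℂ) : Matrix (Fin n) (Fin n) ℂ) := by
      rw [Units.val_mul, Units.val_mul, mul_apply_eq_vecMul, ← vecMul_vecMul, hR,
        updateRow_self]
    rw [_root_.mul_inv_rev, inv_inv, h1, mul_inv_cancel, Units.val_one, vecMul_one]
  · have h1 : (R : Matrix (Fin n) (Fin n) ℂ) *ᵥ Pi.single b 1 = Pi.single b 1 := by
      ext i
      rw [mulVec_single_one, col_apply, hR]
      by_cases hi : i = a
      · subst hi
        rw [updateRow_self, hψb, Pi.single_eq_of_ne hab]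
      · rw [updateRow_ne hi, one_apply, Pi.single_apply]
    have h2 : ((R⁻¹ : GL (Fin n) ℂ) : Matrix (Fin n) (Fin n) ℂ) *ᵥ Pi.single b 1 =
        Pi.single b 1 := by
      conv_lhs => rw [← h1]
      rw [mulVec_mulVec, ← Units.val_mul, inv_mul_cancel, Units.val_one, one_mulVec]
    have h3 : ((C * R⁻¹ : GL (Fin n) ℂ) : Matrix (Fin n) (Fin n) ℂ) *ᵥ Pi.single b 1 = w := by
      rw [Units.val_mul, ← mulVec_mulVec, h2, mulVec_single_one]
      exact funext hCb
    rw [mulVec_single_one] at h3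
    exact congrFun h3 k

theorem orbit_muHeis_iff (hn : 2 ≤ n) (μ : Vn n) : μ ∈ orbit (muHeis n) ↔
    ∃ φ w : Fin n → ℂ, φ ≠ 0 ∧ w ≠ 0 ∧ φ ⬝ᵥ w = 0 ∧ ∀ i j k, μ i j k = φ i * φ j * w k := by
  set a : Fin n := ⟨0, by omega⟩
  set b : Fin n := ⟨1, by omega⟩
  have hab : a ≠ b := by simp [a, b, Fin.ext_iff]
  constructor
  · rintro ⟨g, rfl⟩
    have h1 : (↑g⁻¹ : Matrix (Fin n) (Fin n) ℂ) * (g : Matrix (Fin n) (Fin n) ℂ) = 1 := by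
      rw [← Units.val_mul, inv_mul_cancel, Units.val_one]
    have h2 := fun i j => congrFun (congrFun h1 i) j
    simp only [mul_apply'] at h2
    refine ⟨(↑g⁻¹ : Matrix (Fin n) (Fin n) ℂ) a, fun k => (g : Matrix (Fin n) (Fin n) ℂ) k b,
      ?_, ?_, (h2 a b).trans (one_apply_ne hab), gAct_muHeis hn g⟩
    · intro h
      have := h2 a a
      simp [h] at this
    · intro h
      have := h2 b b
      simp [h] at this
  · rintro ⟨φ, w, hφ, hw, h, hμ⟩
    obtain ⟨g, h1, h2⟩ := exists_GL a b hab hφ hw h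
    refine ⟨g, ?_⟩
    funext i j k
    rw [gAct_muHeis hn, h1, h1, h2, hμ]

theorem flatIn_mul_flatOut_apply {μ : Vn n} {φ w : Fin n → ℂ}
    (hμ : ∀ i j k, μ i j k = φ i * φ j * w k) (p q : Fin n × Fin n) :
    (flatIn μ * flatOut μ) p q = φ p.1 * w p.2 * φ q.1 * φ q.2 * (φ ⬝ᵥ w) := by
  rw [mul_apply, dotProduct, Finset.mul_sum]
  refine Finset.sum_congr rfl fun j _ => ?_
  simp only [flatIn, flatOut, of_apply, hμ]
  ring

theorem trace_Mmat_sq_eq_iff {μ : Vn n} (hs : IsSymm μ) (h0 : μ ≠ 0) :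
    (trace (Mmat μ * Mmat μ)).re = 5 * normSqV μ ^ 2 ↔
    ∃ φ w : Fin n → ℂ, φ ≠ 0 ∧ w ≠ 0 ∧ φ ⬝ᵥ w = 0 ∧ ∀ i j k, μ i j k = φ i * φ j * w k := by
  have hid := trace_Mmat_sq_add_deficit μ
  constructor
  · intro h
    have hA := frobSq_nonneg (minors (flatIn μ))
    have hB := frobSq_nonneg (minors (flatOut μ)ᴴ)
    have hC := frobSq_nonneg (flatIn μ * flatOut μ)
    have hA0 : minors (flatIn μ) = 0 := frobSq_eq_zero_iff.1 (by linarith)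
    have hC0 : flatIn μ * flatOut μ = 0 := frobSq_eq_zero_iff.1 (by linarith)
    obtain ⟨φ, w, hφ, hw, hμ⟩ := exists_eq_mul_of_minors hs h0 hA0
    refine ⟨φ, w, hφ, hw, ?_, hμ⟩
    obtain ⟨i, hi⟩ := Function.ne_iff.1 hφ
    obtain ⟨k, hk⟩ := Function.ne_iff.1 hw
    have h1 : φ i * w k * φ i * φ i * (φ ⬝ᵥ w) = 0 :=
      (flatIn_mul_flatOut_apply hμ (i, k) (i, i)).symm.trans (congrFun (congrFun hC0 _) _)
    exact (mul_eq_zero.1 h1).resolve_left (mul_ne_zero (mul_ne_zero (mul_ne_zero hi hk) hi) hi)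
  · rintro ⟨φ, w, -, -, h, hμ⟩
    have hA0 : minors (flatIn μ) = 0 := by
      ext p q
      simp only [minors, flatIn, of_apply, hμ, Matrix.zero_apply]
      ring
    have hB0 : minors (flatOut μ)ᴴ = 0 := by
      ext p q
      simp only [minors, flatOut, conjTranspose_apply, of_apply, hμ, star_mul, Matrix.zero_apply]
      ring
    have hC0 : flatIn μ * flatOut μ = 0 := by
      ext p q
      rw [flatIn_mul_flatOut_apply hμ, h, mul_zero, Matrix.zero_apply]
    rw [← hid, frobSq_eq_zero_iff.2 hA0, frobSq_eq_zero_iff.2 hB0, frobSq_eq_zero_iff.2 hC0]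
    ring

end Vn

/-- for `n ≥ 2` the maximum of the energy `E_n` on nonzero Jordan algebras
is `5`, attained exactly on the orbit of `μ_Heis`. -/
theorem stmt11 {n : ℕ} (hn : 2 ≤ n) (μ : Vn n) (hJ : Vn.IsJordan μ) (h0 : μ ≠ 0) :
    Vn.energy μ ≤ 5 ∧ (Vn.energy μ = 5 ↔ μ ∈ Vn.orbit (muHeis n)) := by
  have hN : 0 < Vn.normSqV μ ^ 2 := pow_pos (Vn.normSqV_pos h0) 2
  rw [Vn.orbit_muHeis_iff hn, ← Vn.trace_Mmat_sq_eq_iff hJ.1 h0, Vn.energy, div_le_iff₀ hN,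
    div_eq_iff hN.ne']
  refine ⟨?_, Iff.rfl⟩
  have hA := Vn.frobSq_nonneg (Vn.minors (Vn.flatIn μ))
  have hB := Vn.frobSq_nonneg (Vn.minors (Vn.flatOut μ)ᴴ)
  have hC := Vn.frobSq_nonneg (Vn.flatIn μ * Vn.flatOut μ)
  rw [← Vn.trace_Mmat_sq_add_deficit]
  exact le_add_of_nonneg_right (by positivity)
end
end
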